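/- arXiv:1404.4216 — 5 statements merged into one kernel-verified Lean document; each statement's English description precedes it below -/
import Mathlib

section
/- Let R be a polynomial ring over a perfect field k of prime characteristic p, let 𝔞 be an ideal of R, let e ≥ 0 and q = p^e, and define 𝔞^[1/q] as the infimum of all ideals 𝔟 of R with 𝔞 ⊆ 𝔟^[q]. Then 𝔞 ⊆ (𝔞^[1/q])^[q]; equivalently, the intersection of 𝔟^[q] over all ideals 𝔟 with 𝔞 ⊆ 𝔟^[q] equals (⋂ 𝔟)^[q], so 𝔞^[1/q] is the unique smallest ideal 𝔟 with 𝔞 ⊆ 𝔟^[q]. -/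
open Filter Topology

noncomputable section

/-- The Frobenius power `I^[q]`: the ideal generated by the `q`-th powers of elements of `I`. -/
def frobeniusPower {R : Type*} [CommRing R] (I : Ideal R) (q : ℕ) : Ideal R :=
  Ideal.span ((fun f => f ^ q) '' (I : Set R))

/-- The `e`-th root `I^[1/q]` (with `q = p^e`): the infimum of the ideals `J` with
`I ⊆ J^[q]`. -/
def ethRoot {R : Type*} [CommRing R] (I : Ideal R) (q : ℕ) : Ideal R :=
  sInf {J : Ideal R | I ≤ frobeniusPower J q}

/-- The generalized test ideal `τ(lam • I)` in characteristic `p`: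
`τ(lam • I) = ⋃_e (I^⌈lam·p^e⌉)^[1/p^e]`, an increasing union, i.e. a supremum. -/
def testIdeal {R : Type*} [CommRing R] (p : ℕ) (I : Ideal R) (lam : ℝ) : Ideal R :=
  ⨆ e : ℕ, ethRoot (I ^ ⌈lam * (p : ℝ) ^ e⌉₊) (p ^ e)

/-- `lam` is an F-jumping number of `I`: `τ(lam • I) ≠ τ((lam - δ) • I)` for every `δ > 0`. -/
def IsFJumpingNumber {R : Type*} [CommRing R] (p : ℕ) (I : Ideal R) (lam : ℝ) : Prop :=
  0 < lam ∧ ∀ δ : ℝ, 0 < δ → testIdeal p I lam ≠ testIdeal p I (lam - δ)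

/-- The F-pure threshold of `I`: `min {lam > 0 | τ(lam • I) ≠ R}`. -/
def fpt {R : Type*} [CommRing R] (p : ℕ) (I : Ideal R) : ℝ :=
  sInf {lam : ℝ | 0 < lam ∧ testIdeal p I lam ≠ ⊤}

/-- `ν^b_a(q) = max { r : a^r ⊄ b^[q] }`. -/
def nu {R : Type*} [CommRing R] (a b : Ideal R) (q : ℕ) : ℕ :=
  sSup {r : ℕ | ¬ a ^ r ≤ frobeniusPower b q}

/-- The F-threshold `c^b(a) = lim_e ν^b_a(p^e)/p^e = sup_e ν^b_a(p^e)/p^e`. -/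
def fThreshold {R : Type*} [CommRing R] (p : ℕ) (a b : Ideal R) : ℝ :=
  ⨆ e : ℕ, (nu a b (p ^ e) : ℝ) / (p : ℝ) ^ e

/-- The ideal of `t × t` minors of the `m × n` matrix of indeterminates `(x_{ij})`. -/
def minorsIdeal (k : Type*) [Field k] (m n t : ℕ) :
    Ideal (MvPolynomial (Fin m × Fin n) k) :=
  Ideal.span { d | ∃ (r : Fin t ↪ Fin m) (c : Fin t ↪ Fin n),
    d = Matrix.det (Matrix.of fun i j => MvPolynomial.X (r i, c j)) }

open MvPolynomial Classical in
/-- The `k`-linear map sending `X ^ (q • d + r)` to `X ^ d`, for `r` with entries less than `q`, and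
every monomial whose exponent is not congruent to `r` modulo `q` to zero. -/
def residueComponent {k σ : Type*} [CommRing k] (q : ℕ) (r : σ →₀ ℕ) :
    MvPolynomial σ k →ₗ[k] MvPolynomial σ k :=
  (basisMonomials σ k).constr k fun m =>
    if m.mapRange (· % q) (Nat.zero_mod q) = r then
      monomial (m.mapRange (· / q) (Nat.zero_div q)) 1 else 0

open MvPolynomial Classical in
lemma residueComponent_monomial {k σ : Type*} [CommRing k] (q : ℕ) (r m : σ →₀ ℕ) (c : k) :
    residueComponent q r (monomial m c) =
      if m.mapRange (· % q) (Nat.zero_mod q) = r then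
        monomial (m.mapRange (· / q) (Nat.zero_div q)) c else 0 := by
  have h : monomial m c = c • basisMonomials σ k m := by
    rw [coe_basisMonomials, smul_monomial, smul_eq_mul, mul_one]
  rw [h, map_smul, residueComponent, Module.Basis.constr_basis]
  split_ifs <;> simp [smul_monomial]

open MvPolynomial in
lemma residueComponent_mul_expand {k σ : Type*} [CommRing k] {q : ℕ} (hq : 0 < q) (r : σ →₀ ℕ)
    (f g : MvPolynomial σ k) :
    residueComponent q r (f * expand q g) = residueComponent q r f * g := by
  induction f using MvPolynomial.induction_on' with
  | add f₁ f₂ h₁ h₂ => rw [add_mul, map_add, h₁, h₂, map_add, add_mul]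
  | monomial m a =>
    induction g using MvPolynomial.induction_on' with
    | add g₁ g₂ h₁ h₂ => rw [map_add, mul_add, map_add, h₁, h₂, mul_add]
    | monomial d b =>
      have hmod : (m + q • d).mapRange (· % q) (Nat.zero_mod q) =
          m.mapRange (· % q) (Nat.zero_mod q) := by
        ext i; simp
      have hdiv : (m + q • d).mapRange (· / q) (Nat.zero_div q) =
          m.mapRange (· / q) (Nat.zero_div q) + d := by
        ext i; simp [Nat.add_mul_div_left _ _ hq]
      rw [expand_monomial, monomial_mul, residueComponent_monomial, residueComponent_monomial,
        hmod, hdiv]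
      split_ifs <;> simp [monomial_mul]

open MvPolynomial in
lemma sum_expand_residueComponent {k σ : Type*} [CommRing k] [Fintype σ] [DecidableEq σ] {q : ℕ} (hq : 0 < q)
    (f : MvPolynomial σ k) :
    ∑ r ∈ Finset.Iic (Finsupp.equivFunOnFinite.symm fun _ : σ => q),
      monomial r 1 * expand q (residueComponent q r f) = f := by
  induction f using MvPolynomial.induction_on' with
  | add f₁ f₂ h₁ h₂ => simp only [map_add, mul_add, Finset.sum_add_distrib, h₁, h₂]
  | monomial m a =>
    rw [Finset.sum_eq_single (m.mapRange (· % q) (Nat.zero_mod q))]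
    · rw [residueComponent_monomial, if_pos rfl, expand_monomial, monomial_mul, one_mul]
      congr 1
      congr 1
      ext i
      simp [Nat.mod_add_div]
    · intro r _ hr
      rw [residueComponent_monomial, if_neg hr.symm, map_zero, mul_zero]
    · intro h
      refine absurd (Finset.mem_Iic.mpr fun i => ?_) h
      simpa using (Nat.mod_lt _ hq).le

open MvPolynomial in
/-- Over a perfect field, membership in `b^[p^e]` is detected by membership in `b` of the
coordinates with respect to the monomial basis over the `p^e`-th powers. -/
lemma mem_frobeniusPower_iff {k : Type*} [Field k] (p : ℕ) [Fact p.Prime] [CharP k p]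
    [PerfectRing k p] {σ : Type*} [Fintype σ] (e : ℕ) (b : Ideal (MvPolynomial σ k))
    (f : MvPolynomial σ k) :
    f ∈ frobeniusPower b (p ^ e) ↔
      ∀ r, residueComponent (p ^ e) r
        (map (iterateFrobeniusEquiv k p e).symm.toRingHom f) ∈ b := by
  classical
  have hq : 0 < p ^ e := pow_pos (Fact.out : p.Prime).pos e
  have hleft : (iterateFrobeniusEquiv k p e).symm.toRingHom.comp (iterateFrobenius k p e) =
      RingHom.id k := RingHom.ext (iterateFrobeniusEquiv k p e).symm_apply_apply
  have hright : (iterateFrobenius k p e).comp (iterateFrobeniusEquiv k p e).symm.toRingHom =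
      RingHom.id k := RingHom.ext (iterateFrobeniusEquiv k p e).apply_symm_apply
  constructor
  · intro hf r
    suffices H : ∀ h, residueComponent (p ^ e) r
        (map (iterateFrobeniusEquiv k p e).symm.toRingHom (h * f)) ∈ b by
      simpa only [one_mul] using H 1
    refine Submodule.span_induction (p := fun f _ => ∀ h, residueComponent (p ^ e) r
      (map (iterateFrobeniusEquiv k p e).symm.toRingHom (h * f)) ∈ b) ?_ ?_ ?_ ?_ hf
    · rintro _ ⟨g, hg, rfl⟩ h
      have hinv : map (iterateFrobeniusEquiv k p e).symm.toRingHom (g ^ p ^ e) =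
          expand (p ^ e) g := by
        rw [← map_iterateFrobenius_expand, MvPolynomial.map_map, hleft, MvPolynomial.map_id]
      simp only [map_mul, hinv]
      rw [residueComponent_mul_expand hq]
      exact b.mul_mem_left _ hg
    · intro h
      simp
    · intro x y _ _ hx hy h
      rw [mul_add, map_add, map_add]
      exact b.add_mem (hx h) (hy h)
    · intro c x _ hx h
      rw [smul_eq_mul, ← mul_assoc]
      exact hx (h * c)
  · intro hf
    have hsum := congrArg (MvPolynomial.map (iterateFrobenius k p e)) (sum_expand_residueComponent hq
      (map (iterateFrobeniusEquiv k p e).symm.toRingHom f))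
    rw [MvPolynomial.map_map, hright, MvPolynomial.map_id] at hsum
    rw [← hsum, map_sum]
    refine Ideal.sum_mem _ fun r _ => ?_
    rw [map_mul, map_iterateFrobenius_expand]
    exact Ideal.mul_mem_left _ _ (Ideal.subset_span ⟨_, hf r, rfl⟩)

lemma frobeniusPower_sInf {k : Type*} [Field k] (p : ℕ) [Fact p.Prime] [CharP k p]
    [PerfectRing k p] {σ : Type*} [Fintype σ] (e : ℕ) (S : Set (Ideal (MvPolynomial σ k))) :
    frobeniusPower (sInf S) (p ^ e) = ⨅ b ∈ S, frobeniusPower b (p ^ e) := by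
  ext f
  simp only [mem_frobeniusPower_iff, Ideal.mem_iInf, Submodule.mem_sInf]
  exact ⟨fun h b hb r => h r b hb, fun h r b hb => h b hb r⟩

/-- In a polynomial ring over a perfect field of prime characteristic `p`, for any ideal `𝔞`
and `q = p^e`: `𝔞 ⊆ (𝔞^[1/q])^[q]`; equivalently the intersection of `𝔟^[q]` over all
ideals `𝔟` with `𝔞 ⊆ 𝔟^[q]` equals `(⋂ 𝔟)^[q]`, so `𝔞^[1/q]` is the unique smallest
ideal `𝔟` with `𝔞 ⊆ 𝔟^[q]`. -/
theorem ethRoot_spec (k : Type*) [Field k] (p : ℕ) [Fact p.Prime] [CharP k p]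
    [PerfectRing k p] (σ : Type*) [Fintype σ] (a : Ideal (MvPolynomial σ k))
    (e : ℕ) (q : ℕ) (hq : q = p ^ e) :
    a ≤ frobeniusPower (ethRoot a q) q ∧
      (⨅ b ∈ {b : Ideal (MvPolynomial σ k) | a ≤ frobeniusPower b q}, frobeniusPower b q) =
        frobeniusPower (sInf {b : Ideal (MvPolynomial σ k) | a ≤ frobeniusPower b q}) q ∧
      IsLeast {b : Ideal (MvPolynomial σ k) | a ≤ frobeniusPower b q} (ethRoot a q) := by
  subst hq
  have hle : a ≤ frobeniusPower (ethRoot a (p ^ e)) (p ^ e) := by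
    rw [ethRoot, frobeniusPower_sInf]
    exact le_iInf₂ fun b hb => hb
  exact ⟨hle, (frobeniusPower_sInf p e _).symm, hle, fun b hb => sInf_le hb⟩
end
end

section
/- Let R be a polynomial ring over a perfect field k of prime characteristic p, let 𝔞 be an ideal of R, let W be a submonoid of R (a multiplicative system), and let e ≥ 0, q = p^e. Then in the localization W^{-1}R one has (W^{-1}𝔞)^[1/q] = W^{-1}(𝔞^[1/q]), where W^{-1}𝔞 denotes the extension of 𝔞 to W^{-1}R and the e-th root in W^{-1}R is defined by the same infimum formula 𝔠^[1/q] = inf{𝔟 : 𝔠 ⊆ 𝔟^[q]}. -/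
open Filter Topology

noncomputable section

theorem frobeniusPower_eq_map {R : Type*} [CommRing R] (p : ℕ) [ExpChar R p] (I : Ideal R)
    (e : ℕ) : frobeniusPower I (p ^ e) = I.map (iterateFrobenius R p e) :=
  rfl

/-- Over a perfect ring of characteristic `p`, every polynomial is a combination of monomials with
`p ^ e`-th powers as coefficients, in an additive way that commutes with multiplication by
`p ^ e`-th powers. -/
theorem MvPolynomial.exists_frobenius_coordinates (k : Type*) [CommRing k] (p : ℕ) [ExpChar k p]
    [PerfectRing k p] (σ : Type*) (e : ℕ) :
    ∃ c : MvPolynomial σ k →+ ((σ →₀ ℕ) →₀ MvPolynomial σ k),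
      (∀ f, (c f).sum (fun α g => g ^ p ^ e * MvPolynomial.monomial α 1) = f) ∧
      ∀ w f α, c (w ^ p ^ e * f) α = w * c f α := by
  have hq : 0 < p ^ e := pow_pos (expChar_pos k p) e
  let quo : (σ →₀ ℕ) → (σ →₀ ℕ) := Finsupp.mapRange (· / p ^ e) (Nat.zero_div _)
  let rem : (σ →₀ ℕ) → (σ →₀ ℕ) := Finsupp.mapRange (· % p ^ e) (Nat.zero_mod _)
  let root := (iterateFrobeniusEquiv k p e).symm
  have root_pow (r : k) : root r ^ p ^ e = r :=
    (iterateFrobeniusEquiv k p e).apply_symm_apply r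
  have pow_root (r : k) : root (r ^ p ^ e) = r :=
    (iterateFrobeniusEquiv k p e).symm_apply_apply r
  let c : MvPolynomial σ k →+ ((σ →₀ ℕ) →₀ MvPolynomial σ k) :=
    (Finsupp.liftAddHom fun m => (Finsupp.singleAddHom (rem m)).comp
      ((MvPolynomial.monomial (quo m)).toAddMonoidHom.comp root.toAddMonoidHom)).comp
      (AddMonoidAlgebra.coeffAddEquiv (R := k) (M := σ →₀ ℕ)).toAddMonoidHom
  have c_monomial (m : σ →₀ ℕ) (r : k) :
      c (MvPolynomial.monomial m r) =
        Finsupp.single (rem m) (MvPolynomial.monomial (quo m) (root r)) := by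
    change Finsupp.liftAddHom _ (Finsupp.single m r) = _
    rw [Finsupp.liftAddHom_apply_single]
    rfl
  have frob_add (x y : MvPolynomial σ k) : (x + y) ^ p ^ e = x ^ p ^ e + y ^ p ^ e :=
    add_pow_expChar_pow x y p e
  refine ⟨c, fun f => ?_, fun w f α => ?_⟩
  · induction f using MvPolynomial.induction_on' with
    | monomial m r =>
      rw [c_monomial, Finsupp.sum_single_index (by rw [zero_pow hq.ne', zero_mul]),
        MvPolynomial.monomial_pow, root_pow, MvPolynomial.monomial_mul, mul_one]
      congr 2
      ext i
      simpa [quo, rem] using Nat.div_add_mod (m i) (p ^ e)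
    | add f g hf hg =>
      rw [map_add, Finsupp.sum_add_index', hf, hg]
      · intro α
        rw [zero_pow hq.ne', zero_mul]
      · intro α x y
        rw [frob_add, add_mul]
  · induction w using MvPolynomial.induction_on' with
    | add w w' hw hw' => rw [frob_add, add_mul, map_add, Finsupp.add_apply, hw, hw', add_mul]
    | monomial u s =>
      induction f using MvPolynomial.induction_on' with
      | add f g hf hg =>
        rw [mul_add, map_add, Finsupp.add_apply, hf, hg, map_add, Finsupp.add_apply, mul_add]
      | monomial v t =>
        have hrem : rem (p ^ e • u + v) = rem v := by
          ext i
          simp [rem]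
        have hquo : quo (p ^ e • u + v) = u + quo v := by
          ext i
          simp [quo, Nat.mul_add_div hq]
        rw [MvPolynomial.monomial_pow, MvPolynomial.monomial_mul, c_monomial, c_monomial, hrem,
          hquo, map_mul, pow_root, ← MvPolynomial.monomial_mul]
        classical
        rw [Finsupp.single_apply, Finsupp.single_apply, mul_ite, mul_zero]

section FrobeniusCoordinates

variable {R ι : Type*} [CommRing R] {q : ℕ} {c : R →+ (ι →₀ R)} {b : ι → R}

/-- Membership in a Frobenius power is tested on coordinates with respect to `q`-th powers. -/
theorem mem_frobeniusPower_iff_s10 (hsum : ∀ f, (c f).sum (fun α g => g ^ q * b α) = f)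
    (hmul : ∀ w f α, c (w ^ q * f) α = w * c f α) {J : Ideal R} {f : R} :
    f ∈ frobeniusPower J q ↔ ∀ α, c f α ∈ J := by
  refine ⟨fun hf => ?_, fun hf => ?_⟩
  · refine Submodule.span_induction ?_ ?_ ?_ ?_ (p := fun f _ => ∀ r α, c (r * f) α ∈ J) hf 1
      |> fun h α => by simpa using h α
    · rintro _ ⟨j, hj, rfl⟩ r α
      rw [mul_comm, hmul]
      exact J.mul_mem_right _ hj
    · simp
    · intro x y _ _ hx hy r α
      rw [mul_add, map_add, Finsupp.add_apply]
      exact J.add_mem (hx r α) (hy r α)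
    · intro s x _ hx r α
      rw [smul_eq_mul, ← mul_assoc]
      exact hx (r * s) α
  · rw [← hsum f]
    exact sum_mem fun α _ => Ideal.mul_mem_right _ _ (Ideal.subset_span ⟨_, hf α, rfl⟩)

theorem le_frobeniusPower_ethRoot (hsum : ∀ f, (c f).sum (fun α g => g ^ q * b α) = f)
    (hmul : ∀ w f α, c (w ^ q * f) α = w * c f α) (I : Ideal R) :
    I ≤ frobeniusPower (ethRoot I q) q := fun _ hf =>
  (mem_frobeniusPower_iff_s10 hsum hmul).2 fun α => (Submodule.mem_sInf).2 fun _ hJ =>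
    (mem_frobeniusPower_iff_s10 hsum hmul).1 (hJ hf) α

end FrobeniusCoordinates

theorem map_frobeniusPower {R S : Type*} [CommRing R] [CommRing S] (φ : R →+* S) (p : ℕ)
    [ExpChar R p] [ExpChar S p] (I : Ideal R) (e : ℕ) :
    (frobeniusPower I (p ^ e)).map φ = frobeniusPower (I.map φ) (p ^ e) := by
  rw [frobeniusPower_eq_map, frobeniusPower_eq_map, Ideal.map_map, Ideal.map_map,
    φ.iterateFrobenius_comm]

theorem ethRoot_map_algebraMap {R S ι : Type*} [CommRing R] [CommRing S] [Algebra R S]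
    (W : Submonoid R) [IsLocalization W S] (p e : ℕ) [ExpChar R p] [ExpChar S p]
    {c : R →+ (ι →₀ R)} {b : ι → R}
    (hsum : ∀ f, (c f).sum (fun α g => g ^ p ^ e * b α) = f)
    (hmul : ∀ w f α, c (w ^ p ^ e * f) α = w * c f α) (I : Ideal R) :
    ethRoot (I.map (algebraMap R S)) (p ^ e) = (ethRoot I (p ^ e)).map (algebraMap R S) := by
  apply le_antisymm
  · refine sInf_le ?_
    rw [Set.mem_ofPred_eq, ← map_frobeniusPower]
    exact Ideal.map_mono (le_frobeniusPower_ethRoot hsum hmul I)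
  · refine le_sInf fun J hJ => Ideal.map_le_iff_le_comap.2 (sInf_le fun f hf => ?_)
    rw [Set.mem_ofPred_eq, ← IsLocalization.map_under W S J, ← map_frobeniusPower] at hJ
    obtain ⟨w, hw, hwf⟩ := (IsLocalization.algebraMap_mem_map_algebraMap_iff W S _ _).1
      (hJ (Ideal.mem_map_of_mem _ hf))
    refine (mem_frobeniusPower_iff_s10 hsum hmul).2 fun α => ?_
    have hq : p ^ e ≠ 0 := (pow_pos (expChar_pos R p) e).ne'
    have hpow : w ^ p ^ e * f ∈ frobeniusPower (J.comap (algebraMap R S)) (p ^ e) := by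
      rw [← Nat.sub_one_add_one hq, pow_succ, mul_assoc, Nat.sub_one_add_one hq]
      exact Ideal.mul_mem_left _ _ hwf
    have hc := (mem_frobeniusPower_iff_s10 hsum hmul).1 hpow α
    rw [hmul, Ideal.mem_comap, map_mul] at hc
    exact (Ideal.unit_mul_mem_iff_mem _ (IsLocalization.map_units S ⟨w, hw⟩)).1 hc

/-- In a polynomial ring `R` over a perfect field of prime characteristic `p`, the `e`-th
root commutes with localization at a multiplicative system `W`:
`(W⁻¹𝔞)^[1/q] = W⁻¹(𝔞^[1/q])` for `q = p^e`. -/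
theorem ethRoot_localization (k : Type*) [Field k] (p : ℕ) [Fact p.Prime] [CharP k p]
    [PerfectRing k p] (σ : Type*) [Fintype σ] (a : Ideal (MvPolynomial σ k))
    (W : Submonoid (MvPolynomial σ k)) (e : ℕ) (q : ℕ) (hq : q = p ^ e) :
    ethRoot (Ideal.map (algebraMap (MvPolynomial σ k) (Localization W)) a) q =
      Ideal.map (algebraMap (MvPolynomial σ k) (Localization W)) (ethRoot a q) := by
  subst hq
  rcases subsingleton_or_nontrivial (Localization W) with _ | _
  · exact Subsingleton.elim _ _
  have : CharP (Localization W) p := charP_of_injective_algebraMap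
    ((algebraMap (MvPolynomial σ k) (Localization W)).comp MvPolynomial.C).injective p
  obtain ⟨c, hsum, hmul⟩ := MvPolynomial.exists_frobenius_coordinates k p σ e
  exact ethRoot_map_algebraMap W p e hsum hmul a
end
end

section
/- Let k be a perfect field of prime characteristic p, let R = k[z_1, …, z_r] and T = k[z_1, …, z_r, …, z_s] with the natural inclusion R ⊆ T (r ≤ s), let 𝔞 be an ideal of R, and let e ≥ 0, q = p^e. Then (𝔞T)^[1/q] = (𝔞^[1/q])T, where 𝔞T denotes the extension of 𝔞 to T and the e-th root in each polynomial ring is the infimum of all ideals 𝔟 with the given ideal contained in 𝔟^[q]. -/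
open Filter Topology

noncomputable section

namespace MvPolynomial

variable {σ τ k : Type*}

/-- The coordinatewise remainders of an exponent vector modulo `q`. -/
def expMod (q : ℕ) (n : σ →₀ ℕ) : σ →₀ ℕ := n.mapRange (· % q) (Nat.zero_mod q)

/-- The coordinatewise quotients of an exponent vector by `q`. -/
def expDiv (q : ℕ) (n : σ →₀ ℕ) : σ →₀ ℕ := n.mapRange (· / q) (Nat.zero_div q)

theorem smul_expDiv_add_expMod (q : ℕ) (n : σ →₀ ℕ) : q • expDiv q n + expMod q n = n := by
  ext i
  simp [expDiv, expMod, Nat.div_add_mod]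

theorem expMod_smul_add (q : ℕ) (m n : σ →₀ ℕ) : expMod q (q • m + n) = expMod q n := by
  ext i
  simp [expMod]

theorem expDiv_smul_add {q : ℕ} (hq : 0 < q) (m n : σ →₀ ℕ) :
    expDiv q (q • m + n) = m + expDiv q n := by
  ext i
  simp [expDiv, Nat.mul_add_div hq]

theorem mapDomain_mapRange_of_injective {ι : σ → τ} (hι : Function.Injective ι) (g : ℕ → ℕ)
    (hg : g 0 = 0) (n : σ →₀ ℕ) :
    (n.mapDomain ι).mapRange g hg = (n.mapRange g hg).mapDomain ι := by
  ext t
  by_cases ht : t ∈ Set.range ι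
  · obtain ⟨i, rfl⟩ := ht
    simp [Finsupp.mapDomain_apply hι]
  · simp [Finsupp.mapDomain_of_notMem_range _ _ ht, hg]

theorem expMod_mapDomain {ι : σ → τ} (hι : Function.Injective ι) (q : ℕ) (n : σ →₀ ℕ) :
    expMod q (n.mapDomain ι) = (expMod q n).mapDomain ι :=
  mapDomain_mapRange_of_injective hι _ _ n

theorem expDiv_mapDomain {ι : σ → τ} (hι : Function.Injective ι) (q : ℕ) (n : σ →₀ ℕ) :
    expDiv q (n.mapDomain ι) = (expDiv q n).mapDomain ι :=
  mapDomain_mapRange_of_injective hι _ _ n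

variable [Field k] (p : ℕ) [Fact p.Prime] [CharP k p] [PerfectRing k p] (e : ℕ)

open Classical in
/-- The polynomial `c` appearing as the coordinate at `z^d` when a polynomial is written as
`∑ d, c_d ^ (p ^ e) * z^d` with all exponents in `d` less than `p ^ e`. -/
def rootCoeff (d : σ →₀ ℕ) : MvPolynomial σ k →+ MvPolynomial σ k :=
  (Finsupp.liftAddHom fun n : σ →₀ ℕ =>
    if expMod (p ^ e) n = d then
      (monomial (R := k) (expDiv (p ^ e) n)).toAddMonoidHom.comp
        (iterateFrobeniusEquiv k p e).symm.toAddEquiv.toAddMonoidHom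
    else 0).comp AddMonoidAlgebra.coeffAddEquiv.toAddMonoidHom

open Classical in
theorem rootCoeff_monomial (d n : σ →₀ ℕ) (a : k) :
    rootCoeff p e d (monomial n a) =
      if expMod (p ^ e) n = d then
        monomial (expDiv (p ^ e) n) ((iterateFrobeniusEquiv k p e).symm a)
      else 0 := by
  have h : AddMonoidAlgebra.coeffAddEquiv (monomial n a) = Finsupp.single n a := rfl
  simp only [rootCoeff, AddMonoidHom.comp_apply, AddEquiv.coe_toAddMonoidHom, h,
    Finsupp.liftAddHom_apply_single]
  split_ifs <;> rfl

theorem rootCoeff_pow_mul (d : σ →₀ ℕ) (g h : MvPolynomial σ k) :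
    rootCoeff p e d (g ^ p ^ e * h) = g * rootCoeff p e d h := by
  have hq : 0 < p ^ e := pow_pos (Fact.out : p.Prime).pos e
  induction g using MvPolynomial.induction_on' with
  | add g₁ g₂ h₁ h₂ => rw [add_pow_char_pow, add_mul, map_add, h₁, h₂, add_mul]
  | monomial m a =>
    induction h using MvPolynomial.induction_on' with
    | add f₁ f₂ h₁ h₂ => rw [mul_add, map_add, h₁, h₂, map_add, mul_add]
    | monomial n b =>
      rw [monomial_pow, monomial_mul, rootCoeff_monomial, rootCoeff_monomial, expMod_smul_add,
        expDiv_smul_add hq, mul_ite, mul_zero, monomial_mul, map_mul,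
        ← iterateFrobeniusEquiv_def, RingEquiv.symm_apply_apply]

theorem exists_eq_sum_rootCoeff (f : MvPolynomial σ k) :
    ∃ S : Finset (σ →₀ ℕ), f = ∑ d ∈ S, rootCoeff p e d f ^ p ^ e * monomial d 1 := by
  classical
  refine ⟨f.support.image (expMod (p ^ e)), ?_⟩
  have key (d : σ →₀ ℕ) : rootCoeff p e d f ^ p ^ e * monomial d 1 =
      ∑ n ∈ f.support with expMod (p ^ e) n = d, monomial n (coeff n f) := by
    conv_lhs => rw [f.as_sum]
    rw [map_sum, sum_pow_char_pow, Finset.sum_mul, Finset.sum_filter]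
    refine Finset.sum_congr rfl fun n _ => ?_
    rw [rootCoeff_monomial]
    split_ifs with h
    · rw [monomial_pow, monomial_mul, ← h, smul_expDiv_add_expMod, mul_one,
        ← iterateFrobeniusEquiv_def, RingEquiv.apply_symm_apply]
    · rw [zero_pow (pow_pos (Fact.out : p.Prime).pos e).ne', zero_mul]
  simp only [key]
  rw [Finset.sum_fiberwise_of_maps_to fun n hn => Finset.mem_image_of_mem _ hn]
  exact f.as_sum

theorem rootCoeff_rename {ι : σ → τ} (hι : Function.Injective ι) (d : σ →₀ ℕ)
    (f : MvPolynomial σ k) :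
    rootCoeff p e (d.mapDomain ι) (rename ι f) = rename ι (rootCoeff p e d f) := by
  classical
  induction f using MvPolynomial.induction_on' with
  | add f₁ f₂ h₁ h₂ => simp only [map_add, h₁, h₂]
  | monomial n a =>
    rw [rename_monomial, rootCoeff_monomial, rootCoeff_monomial, expMod_mapDomain hι,
      expDiv_mapDomain hι]
    simp only [(Finsupp.mapDomain_injective hι).eq_iff]
    split_ifs <;> simp [rename_monomial]

theorem mem_frobeniusPower_iff (J : Ideal (MvPolynomial σ k)) (f : MvPolynomial σ k) :
    f ∈ frobeniusPower J (p ^ e) ↔ ∀ d, rootCoeff p e d f ∈ J := by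
  constructor
  · intro hf d
    suffices h : ∀ r, rootCoeff p e d (r * f) ∈ J by simpa using h 1
    induction hf using Submodule.span_induction with
    | mem x hx =>
      obtain ⟨g, hg, rfl⟩ := hx
      intro r
      rw [mul_comm, rootCoeff_pow_mul]
      exact J.mul_mem_right _ hg
    | zero => simp
    | add x y _ _ hx hy =>
      intro r
      rw [mul_add, map_add]
      exact J.add_mem (hx r) (hy r)
    | smul s x _ hx =>
      intro r
      rw [smul_eq_mul, ← mul_assoc]
      exact hx (r * s)
  · intro h
    obtain ⟨S, hS⟩ := exists_eq_sum_rootCoeff p e f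
    rw [hS]
    exact sum_mem fun d _ => Ideal.mul_mem_right _ _ (Ideal.subset_span ⟨_, h d, rfl⟩)

theorem le_frobeniusPower_ethRoot (I : Ideal (MvPolynomial σ k)) :
    I ≤ frobeniusPower (ethRoot I (p ^ e)) (p ^ e) := fun f hf =>
  (mem_frobeniusPower_iff p e _ f).2 fun d =>
    Submodule.mem_sInf.2 fun J hJ => (mem_frobeniusPower_iff p e J f).1 (hJ hf) d

theorem comap_rename_frobeniusPower_le {ι : σ → τ} (hι : Function.Injective ι)
    (J : Ideal (MvPolynomial τ k)) :
    (frobeniusPower J (p ^ e)).comap (rename ι).toRingHom ≤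
      frobeniusPower (J.comap (rename (R := k) ι).toRingHom) (p ^ e) := fun f hf =>
  (mem_frobeniusPower_iff p e _ f).2 fun d => by
    change rename ι (rootCoeff p e d f) ∈ J
    rw [← rootCoeff_rename p e hι]
    exact (mem_frobeniusPower_iff p e J _).1 hf (d.mapDomain ι)

end MvPolynomial

theorem map_frobeniusPower_le {R S : Type*} [CommRing R] [CommRing S] (φ : R →+* S)
    (J : Ideal R) (q : ℕ) : (frobeniusPower J q).map φ ≤ frobeniusPower (J.map φ) q := by
  rw [Ideal.map_le_iff_le_comap]
  refine Ideal.span_le.2 ?_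
  rintro _ ⟨g, hg, rfl⟩
  exact Ideal.subset_span ⟨φ g, Ideal.mem_map_of_mem φ hg, (map_pow φ g q).symm⟩

/-- Let `R = k[z_1, …, z_r] ⊆ T = k[z_1, …, z_s]` be polynomial rings over a perfect field
of prime characteristic `p` (with `r ≤ s`). For an ideal `𝔞` of `R` and `q = p^e`, one has
`(𝔞T)^[1/q] = (𝔞^[1/q])T`. -/
theorem ethRoot_extension (k : Type*) [Field k] (p : ℕ) [Fact p.Prime] [CharP k p]
    [PerfectRing k p] (r s : ℕ) (hrs : r ≤ s) (a : Ideal (MvPolynomial (Fin r) k))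
    (e : ℕ) (q : ℕ) (hq : q = p ^ e) :
    ethRoot (Ideal.map (MvPolynomial.rename (Fin.castLE hrs)).toRingHom a) q =
      Ideal.map (MvPolynomial.rename (Fin.castLE hrs)).toRingHom (ethRoot a q) := by
  subst hq
  apply le_antisymm
  · exact sInf_le ((Ideal.map_mono (MvPolynomial.le_frobeniusPower_ethRoot p e a)).trans
      (map_frobeniusPower_le _ _ _))
  · refine le_sInf fun J hJ => Ideal.map_le_iff_le_comap.2 (sInf_le ?_)
    exact (Ideal.map_le_iff_le_comap.1 hJ).trans
      (MvPolynomial.comap_rename_frobeniusPower_le p e (Fin.castLE_injective hrs) J)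
end
end

section
/- Let k be a perfect field of prime characteristic p, let R = k[z_1, …, z_s], fix e ≥ 0 and q = p^e, and regard R as a module over itself via the q-power Frobenius (scalar action r • m = r^q · m). Let B be a basis of this module (for example the monomials z_1^{u_1}⋯z_s^{u_s} with 0 ≤ u_i ≤ q − 1). If 𝔞 = (a_1, …, a_t) is an ideal whose generators have basis expansions a_i = Σ_{μ ∈ B} g_{iμ}^q · μ with g_{iμ} ∈ R, then 𝔞^[1/q] is the ideal generated by all the coefficients g_{iμ}, for μ ∈ B and 1 ≤ i ≤ t. -/
open Filter Topology

noncomputable section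

lemma mem_frobeniusPower_of_mem_coeffs {R : Type*} [CommRing R] {ι : Type*} (B : ι → R)
    {q : ℕ} {J : Ideal R} {c : ι →₀ R} (hc : ∀ μ, c μ ∈ J) :
    (c.sum fun μ g => g ^ q * B μ) ∈ frobeniusPower J q :=
  Ideal.sum_mem _ fun μ _ =>
    Ideal.mul_mem_right _ _ (Ideal.subset_span ⟨c μ, hc μ, rfl⟩)

/-- If `B` spans `R` over its subring of `p^e`-th powers, every element of `J^[p^e]` has an
expansion in `B` with coefficients in `J`. -/
lemma exists_coeffs_of_mem_frobeniusPower {R : Type*} [CommRing R] (p : ℕ) [Fact p.Prime]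
    [CharP R p] (e : ℕ) {ι : Type*} (B : ι → R)
    (hB : ∀ x : R, ∃ c : ι →₀ R, x = c.sum fun μ g => g ^ p ^ e * B μ)
    {J : Ideal R} {x : R} (hx : x ∈ frobeniusPower J (p ^ e)) :
    ∃ c : ι →₀ R, (x = c.sum fun μ g => g ^ p ^ e * B μ) ∧ ∀ μ, c μ ∈ J := by
  have hq : p ^ e ≠ 0 := pow_ne_zero _ (Fact.out : p.Prime).ne_zero
  let S : AddSubmonoid R :=
    { carrier := {x | ∃ c : ι →₀ R, (x = c.sum fun μ g => g ^ p ^ e * B μ) ∧ ∀ μ, c μ ∈ J}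
      zero_mem' := ⟨0, by simp, by simp⟩
      add_mem' := by
        rintro _ _ ⟨c, rfl, hc⟩ ⟨d, rfl, hd⟩
        refine ⟨c + d, ?_, fun μ => J.add_mem (hc μ) (hd μ)⟩
        rw [Finsupp.sum_add_index']
        · intro μ
          rw [zero_pow hq, zero_mul]
        · intro μ a b
          rw [add_pow_char_pow, add_mul] }
  have hmul (r f : R) (hf : f ∈ J) : r * f ^ p ^ e ∈ S := by
    obtain ⟨c, rfl⟩ := hB r
    refine ⟨c.mapRange (· * f) (zero_mul f), ?_, fun μ => ?_⟩
    · rw [Finsupp.sum_mapRange_index (fun μ => by rw [zero_pow hq, zero_mul]), Finsupp.sum_mul]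
      refine Finsupp.sum_congr fun μ _ => ?_
      ring
    · simpa using J.mul_mem_left _ hf
  change x ∈ S
  induction hx using Submodule.span_induction with
  | mem x h =>
    obtain ⟨f, hf, rfl⟩ := h
    simpa using hmul 1 f hf
  | zero => exact S.zero_mem
  | add x y _ _ hx hy => exact S.add_mem hx hy
  | smul r x _ hx =>
    obtain ⟨c, rfl, hc⟩ := hx
    rw [smul_eq_mul, Finsupp.mul_sum]
    refine S.sum_mem fun μ _ => ?_
    convert hmul (r * B μ) (c μ) (hc μ) using 1
    ring

/-- Computing `e`-th roots: let `R = k[z_1, …, z_s]` with `k` a perfect field of prime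
characteristic `p` and `q = p^e`, and let `B : ι → R` be a basis of `R` over `R^q`, i.e.
every element of `R` has a unique representation `Σ_μ g_μ^q · B μ` with coefficients in `R`.
If the generators of `𝔞 = (a_1, …, a_t)` have expansions `a_i = Σ_μ g_{iμ}^q · B μ`, then
`𝔞^[1/q]` is the ideal generated by all the coefficients `g_{iμ}`. -/
theorem ethRoot_eq_span_coeffs (k : Type*) [Field k] (p : ℕ) [Fact p.Prime] [CharP k p]
    [PerfectRing k p] (s : ℕ) (e : ℕ) (q : ℕ) (hq : q = p ^ e) {ι : Type*}
    (B : ι → MvPolynomial (Fin s) k)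
    (hB : ∀ x : MvPolynomial (Fin s) k, ∃! c : ι →₀ MvPolynomial (Fin s) k,
      x = c.sum fun μ g => g ^ q * B μ)
    (t : ℕ) (a : Fin t → MvPolynomial (Fin s) k)
    (g : Fin t → ι →₀ MvPolynomial (Fin s) k)
    (hg : ∀ i, a i = (g i).sum fun μ c => c ^ q * B μ) :
    ethRoot (Ideal.span (Set.range a)) q =
      Ideal.span {x | ∃ i μ, x = g i μ} := by
  subst hq
  refine le_antisymm (sInf_le ?_) (le_sInf fun J hJ => ?_)
  · refine Ideal.span_le.2 ?_
    rintro _ ⟨i, rfl⟩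
    rw [hg i]
    exact mem_frobeniusPower_of_mem_coeffs B fun μ => Ideal.subset_span ⟨i, μ, rfl⟩
  · refine Ideal.span_le.2 ?_
    rintro _ ⟨i, μ, rfl⟩
    obtain ⟨c, hc, hcJ⟩ := exists_coeffs_of_mem_frobeniusPower p e B
      (fun x => (hB x).exists) (hJ (Ideal.subset_span ⟨i, rfl⟩))
    rw [(hB (a i)).unique (hg i) hc]
    exact hcJ μ
end
end

section
/- Let R be a Noetherian commutative ring of prime characteristic p, and let 𝔟 be a proper ideal of R generated by a regular sequence of length r. Then for every e ≥ 0 and q = p^e, one has ν^𝔟_𝔟(q) = r(q − 1), and consequently the F-threshold c^𝔟(𝔟) = lim_{e→∞} ν^𝔟_𝔟(p^e)/p^e equals r. -/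
open Filter Topology

noncomputable section

/-- `IsWeaklyRegularMod I l` says that the list `l` is a weakly regular sequence on `R ⧸ I`,
phrased through membership in the ideals of `R`. -/
def IsWeaklyRegularMod {R : Type*} [CommRing R] : Ideal R → List R → Prop
  | _, [] => True
  | I, a :: l => (∀ x, a * x ∈ I → x ∈ I) ∧ IsWeaklyRegularMod (I ⊔ Ideal.span {a}) l

namespace IsWeaklyRegularMod

variable {R : Type*} [CommRing R]

theorem of_forall_getElem {I : Ideal R} {l : List R}
    (h : ∀ (i : ℕ) (hi : i < l.length) (x : R), l[i] * x ∈ I ⊔ Ideal.ofList (l.take i) →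
      x ∈ I ⊔ Ideal.ofList (l.take i)) : IsWeaklyRegularMod I l := by
  induction l generalizing I with
  | nil => trivial
  | cons a l ih =>
    refine ⟨fun x hx => ?_, ih fun i hi x hx => ?_⟩
    · simpa using h 0 (by simp) x (by simpa using hx)
    · have := h (i + 1) (by simpa using hi) x
      simp only [List.getElem_cons_succ, List.take_succ_cons, Ideal.ofList_cons,
        ← sup_assoc] at this
      exact this hx

theorem of_isWeaklyRegular {l : List R} (h : RingTheory.Sequence.IsWeaklyRegular R l) :
    IsWeaklyRegularMod ⊥ l := by
  refine of_forall_getElem fun i hi x hx => ?_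
  have := (isSMulRegular_quotient_iff_mem_of_smul_mem _ _).mp (h.regular_mod_prev i hi) x
  simp only [smul_eq_mul, Ideal.mul_top] at this
  simpa using this (by simpa using hx)

theorem top (l : List R) : IsWeaklyRegularMod (⊤ : Ideal R) l := by
  induction l with
  | nil => trivial
  | cons a l ih => exact ⟨fun _ _ => trivial, by simpa using ih⟩

/-- If `l` is weakly regular modulo `I + (a)`, then modulo `I` the intersection of `(a)` and `(l)`
is `a • (l)`. -/
theorem exists_mul_sub_mem {I : Ideal R} {a x : R} {l : List R}
    (hl : IsWeaklyRegularMod (I ⊔ Ideal.span {a}) l) (hx : a * x ∈ I ⊔ Ideal.ofList l) :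
    ∃ z ∈ Ideal.ofList l, a * (x - z) ∈ I := by
  induction l generalizing I with
  | nil => exact ⟨0, zero_mem _, by simpa using hx⟩
  | cons g l ih =>
    obtain ⟨hg, hl⟩ := hl
    rw [sup_right_comm] at hl
    rw [Ideal.ofList_cons, ← sup_assoc] at hx
    obtain ⟨z, hz, hmem⟩ := ih hl hx
    obtain ⟨i, hi, s, hs, his⟩ := Submodule.mem_sup.mp hmem
    obtain ⟨m, rfl⟩ := Ideal.mem_span_singleton'.mp hs
    have hm : m ∈ I ⊔ Ideal.span {a} := by
      refine hg m ?_
      have : g * m = a * (x - z) - i := by rw [← his]; ring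
      rw [this]
      exact sub_mem (Ideal.mul_mem_right _ _ (Ideal.mem_sup_right
        (Ideal.mem_span_singleton_self a))) (Ideal.mem_sup_left hi)
    obtain ⟨j, hj, t, ht, rfl⟩ := Submodule.mem_sup.mp hm
    obtain ⟨m, rfl⟩ := Ideal.mem_span_singleton'.mp ht
    refine ⟨z + m * g, ?_, ?_⟩
    · rw [Ideal.ofList_cons]
      exact add_mem (Ideal.mem_sup_right hz)
        (Ideal.mem_sup_left (Ideal.mul_mem_left _ _ (Ideal.mem_span_singleton_self g)))
    · have : a * (x - (z + m * g)) = i + g * j := by linear_combination -his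
      rw [this]
      exact add_mem hi (Ideal.mul_mem_left _ _ hj)

theorem regular_sup_span {I : Ideal R} {a g : R} (ha : ∀ x, a * x ∈ I → x ∈ I)
    (hg : ∀ x, g * x ∈ I ⊔ Ideal.span {a} → x ∈ I ⊔ Ideal.span {a}) (x : R)
    (hx : a * x ∈ I ⊔ Ideal.span {g}) : x ∈ I ⊔ Ideal.span {g} := by
  rw [← Ideal.ofList_singleton] at hx ⊢
  obtain ⟨z, hz, h⟩ := exists_mul_sub_mem (l := [g]) ⟨hg, trivial⟩ hx
  rw [← sub_add_cancel x z]
  exact add_mem (Ideal.mem_sup_left (ha _ h)) (Ideal.mem_sup_right hz)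

theorem sup_span_mul {I : Ideal R} {a b : R} {l : List R} (ha : ∀ x, a * x ∈ I → x ∈ I)
    (hla : IsWeaklyRegularMod (I ⊔ Ideal.span {a}) l)
    (hlb : IsWeaklyRegularMod (I ⊔ Ideal.span {b}) l) :
    IsWeaklyRegularMod (I ⊔ Ideal.span {a * b}) l := by
  induction l generalizing I with
  | nil => trivial
  | cons g l ih =>
    obtain ⟨hga, hla⟩ := hla
    obtain ⟨hgb, hlb⟩ := hlb
    rw [sup_right_comm] at hla hlb
    refine ⟨fun x hx => ?_, ?_⟩
    · obtain ⟨i, hi, s, hs, his⟩ := Submodule.mem_sup.mp hx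
      obtain ⟨t, rfl⟩ := Ideal.mem_span_singleton'.mp hs
      have hxa : x ∈ I ⊔ Ideal.span {a} := by
        refine hga x ?_
        rw [← his]
        refine add_mem (Ideal.mem_sup_left hi) (Ideal.mem_sup_right ?_)
        exact Ideal.mem_span_singleton'.mpr ⟨t * b, by ring⟩
      obtain ⟨j, hj, v, hv, rfl⟩ := Submodule.mem_sup.mp hxa
      obtain ⟨y, rfl⟩ := Ideal.mem_span_singleton'.mp hv
      have h : g * y - t * b ∈ I := by
        refine ha _ ?_
        have : a * (g * y - t * b) = i - g * j := by linear_combination -his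
        rw [this]
        exact sub_mem hi (Ideal.mul_mem_left _ _ hj)
      have hy : y ∈ I ⊔ Ideal.span {b} := by
        refine hgb y ?_
        rw [← sub_add_cancel (g * y) (t * b)]
        exact add_mem (Ideal.mem_sup_left h) (Ideal.mem_sup_right
          (Ideal.mul_mem_left _ _ (Ideal.mem_span_singleton_self b)))
      obtain ⟨k, hk, w, hw, rfl⟩ := Submodule.mem_sup.mp hy
      obtain ⟨u, rfl⟩ := Ideal.mem_span_singleton'.mp hw
      have : j + (k + u * b) * a = (j + k * a) + u * (a * b) := by ring
      rw [this]
      exact add_mem (Ideal.mem_sup_left (add_mem hj (Ideal.mul_mem_right _ _ hk)))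
        (Ideal.mem_sup_right (Ideal.mul_mem_left _ _ (Ideal.mem_span_singleton_self _)))
    · rw [sup_right_comm]
      exact ih (regular_sup_span ha hga) hla hlb

theorem regular_pow {I : Ideal R} {a : R} (ha : ∀ x, a * x ∈ I → x ∈ I) (n : ℕ) (x : R)
    (hx : a ^ n * x ∈ I) : x ∈ I := by
  induction n with
  | zero => simpa using hx
  | succ n ih => exact ih (ha _ (by rwa [← mul_assoc, ← pow_succ']))

theorem sup_span_pow {I : Ideal R} {a : R} {l : List R} (h : IsWeaklyRegularMod I (a :: l))
    (n : ℕ) : IsWeaklyRegularMod (I ⊔ Ideal.span {a ^ n}) l := by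
  induction n with
  | zero => simpa using top l
  | succ n ih =>
    rw [pow_succ']
    exact sup_span_mul h.1 h.2 ih

theorem map_pow {I : Ideal R} {l : List R} (h : IsWeaklyRegularMod I l) (n : ℕ) :
    IsWeaklyRegularMod I (l.map (· ^ n)) := by
  induction l generalizing I with
  | nil => trivial
  | cons a l ih => exact ⟨regular_pow h.1 n, ih (h.sup_span_pow n)⟩

/-- The colon ideal of `(f₁ ^ (n + 1), …, fᵣ ^ (n + 1))` by `f₁ ^ n ⋯ fᵣ ^ n` is contained in
`(f₁, …, fᵣ)`. -/
theorem mem_of_mul_prod_pow_mem {I : Ideal R} {l : List R} (h : IsWeaklyRegularMod I l)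
    (n : ℕ) {y : R}
    (hy : y * (l.map (· ^ n)).prod ∈ I ⊔ Ideal.ofList (l.map (· ^ (n + 1)))) :
    y ∈ I ⊔ Ideal.ofList l := by
  induction l generalizing I with
  | nil => simpa using hy
  | cons a l ih =>
    rw [Ideal.ofList_cons, ← sup_assoc]
    refine ih h.2 ?_
    rw [List.map_cons, List.map_cons, Ideal.ofList_cons, List.prod_cons, sup_left_comm] at hy
    obtain ⟨s, hs, w, hw, hsw⟩ := Submodule.mem_sup.mp hy
    obtain ⟨t, rfl⟩ := Ideal.mem_span_singleton'.mp hs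
    set P := (l.map (· ^ n)).prod
    have hmem : a ^ n * (y * P - a * t) ∈ I ⊔ Ideal.ofList (l.map (· ^ (n + 1))) := by
      have : a ^ n * (y * P - a * t) = w := by linear_combination -hsw
      rwa [this]
    obtain ⟨z, hz, hI⟩ := exists_mul_sub_mem ((h.sup_span_pow n).map_pow (n + 1)) hmem
    have : y * P = (y * P - a * t - z) + t * a + z := by ring
    rw [this]
    exact add_mem (Ideal.mem_sup_left (add_mem (Ideal.mem_sup_left (regular_pow h.1 n _ hI))
      (Ideal.mem_sup_right (Ideal.mul_mem_left _ _ (Ideal.mem_span_singleton_self a)))))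
      (Ideal.mem_sup_right hz)

end IsWeaklyRegularMod

namespace Ideal

variable {R : Type*} [CommRing R]

theorem sup_pow_add_succ_le (I J : Ideal R) (n m : ℕ) :
    (I ⊔ J) ^ (n + m + 1) ≤ I ^ (n + 1) ⊔ J ^ (m + 1) := by
  rw [← add_eq_sup, ← add_eq_sup, add_pow, sum_eq_sup]
  refine Finset.sup_le fun i _ => ?_
  obtain hi | hi := le_or_gt (n + 1) i
  · exact mul_le_left.trans (mul_le_left.trans ((pow_le_pow_right hi).trans le_sup_left))
  · exact mul_le_left.trans (mul_le_right.trans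
      ((pow_le_pow_right (by lia)).trans le_sup_right))

theorem ofList_pow_le (l : List R) (n : ℕ) :
    ofList l ^ (l.length * n + 1) ≤ ofList (l.map (· ^ (n + 1))) := by
  induction l with
  | nil => simp
  | cons a l ih =>
    rw [List.length_cons, List.map_cons, ofList_cons, ofList_cons,
      show (l.length + 1) * n + 1 = n + l.length * n + 1 by ring]
    refine (sup_pow_add_succ_le _ _ _ _).trans (sup_le_sup ?_ ih)
    rw [span_singleton_pow]

theorem prod_map_pow_mem_ofList_pow (l : List R) (n : ℕ) :
    (l.map (· ^ n)).prod ∈ ofList l ^ (l.length * n) := by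
  induction l with
  | nil => simp
  | cons a l ih =>
    rw [List.map_cons, List.prod_cons, ofList_cons, List.length_cons, add_comm, add_mul, one_mul,
      pow_add]
    exact mul_mem_mul (pow_mem_pow (mem_sup_left (mem_span_singleton_self a)) _)
      (pow_right_mono le_sup_right _ ih)

end Ideal

theorem frobeniusPower_ofList {R : Type*} [CommRing R] (p : ℕ) [Fact p.Prime] [CharP R p]
    (l : List R) (e : ℕ) :
    frobeniusPower (Ideal.ofList l) (p ^ e) = Ideal.ofList (l.map (· ^ p ^ e)) := by
  have h : frobeniusPower (Ideal.ofList l) (p ^ e) =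
      (Ideal.ofList l).map (iterateFrobenius R p e) := rfl
  rw [h, Ideal.map_ofList]
  rfl

/-- For a weakly regular sequence `l` generating a proper ideal `𝔟`, one has
`ν^𝔟_𝔟(p ^ e) = l.length * (p ^ e - 1)`. -/
theorem nu_ofList {R : Type*} [CommRing R] (p : ℕ) [Fact p.Prime] [CharP R p] {l : List R}
    (hl : RingTheory.Sequence.IsWeaklyRegular R l) (hne : Ideal.ofList l ≠ ⊤) (e : ℕ) :
    nu (Ideal.ofList l) (Ideal.ofList l) (p ^ e) = l.length * (p ^ e - 1) := by
  obtain ⟨n, hn⟩ : ∃ n, p ^ e = n + 1 :=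
    Nat.exists_eq_succ_of_ne_zero (pow_ne_zero e (Fact.out : p.Prime).ne_zero)
  have hset : {s : ℕ | ¬ Ideal.ofList l ^ s ≤ frobeniusPower (Ideal.ofList l) (p ^ e)} =
      Set.Iic (l.length * n) := by
    ext s
    rw [frobeniusPower_ofList, hn, Set.mem_ofPred_eq, Set.mem_Iic]
    refine ⟨fun h => ?_, fun hs h => hne ?_⟩
    · by_contra! hs
      exact h ((Ideal.pow_le_pow_right hs).trans (Ideal.ofList_pow_le l n))
    · have hmem := h (Ideal.pow_le_pow_right hs (Ideal.prod_map_pow_mem_ofList_pow l n))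
      rw [Ideal.eq_top_iff_one]
      simpa using (IsWeaklyRegularMod.of_isWeaklyRegular hl).mem_of_mul_prod_pow_mem n (y := 1)
        (by simpa using hmem)
  rw [nu, hset, csSup_Iic, hn, Nat.add_sub_cancel]

/-- If `𝔟` is a proper ideal of a Noetherian commutative ring `R` of prime characteristic
`p`, generated by a regular sequence of length `r`, then `ν^𝔟_𝔟(q) = r(q - 1)` for every
`q = p^e`, and consequently the F-threshold `c^𝔟(𝔟) = lim_e ν^𝔟_𝔟(p^e)/p^e` equals `r`. -/
theorem fThreshold_regularSequence (R : Type*) [CommRing R] [IsNoetherianRing R] (p : ℕ)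
    [Fact p.Prime] [CharP R p] (r : ℕ) (f : Fin r → R)
    (hreg : RingTheory.Sequence.IsRegular R (List.ofFn f))
    (b : Ideal R) (hb : b = Ideal.span (Set.range f)) (hbne : b ≠ ⊤) :
    (∀ e : ℕ, nu b b (p ^ e) = r * (p ^ e - 1)) ∧
      Tendsto (fun e : ℕ => (nu b b (p ^ e) : ℝ) / (p : ℝ) ^ e) atTop (𝓝 (r : ℝ)) ∧
      fThreshold p b b = (r : ℝ) := by
  have hlist : b = Ideal.ofList (List.ofFn f) := by
    rw [hb]
    congr 1
    ext x
    simp [List.mem_ofFn]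
  have hnu : ∀ e : ℕ, nu b b (p ^ e) = r * (p ^ e - 1) := fun e => by
    have := nu_ofList p hreg.toIsWeaklyRegular (hlist ▸ hbne) e
    rwa [← hlist, List.length_ofFn] at this
  have hp : 1 < p := (Fact.out : p.Prime).one_lt
  have hdiv : ∀ e : ℕ, (nu b b (p ^ e) : ℝ) / (p : ℝ) ^ e = r * (1 - ((p : ℝ)⁻¹) ^ e) := by
    intro e
    have hpe : (p : ℝ) ^ e ≠ 0 := pow_ne_zero e (by positivity)
    rw [hnu e, Nat.cast_mul, Nat.cast_sub (Nat.one_le_pow _ _ (by lia)), inv_pow]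
    push_cast
    field_simp
  have hinv : (p : ℝ)⁻¹ < 1 := inv_lt_one_of_one_lt₀ (by exact_mod_cast hp)
  have hlim : Tendsto (fun e : ℕ => (nu b b (p ^ e) : ℝ) / (p : ℝ) ^ e) atTop (𝓝 (r : ℝ)) := by
    simp_rw [hdiv]
    simpa using ((tendsto_pow_atTop_nhds_zero_of_lt_one (by positivity) hinv).const_sub 1).const_mul
      (r : ℝ)
  have hmono : Monotone fun e : ℕ => (nu b b (p ^ e) : ℝ) / (p : ℝ) ^ e := by
    intro e e' h
    simp only [hdiv]
    have := pow_le_pow_of_le_one (by positivity) hinv.le h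
    gcongr
  exact ⟨hnu, hlim, tendsto_nhds_unique (tendsto_atTop_ciSup hmono
    ⟨_, Set.forall_mem_range.mpr (hmono.ge_of_tendsto hlim)⟩) hlim⟩
end
end
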